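/- arXiv:2011.04605 — 2 statements merged into one kernel-verified Lean document; each statement's English description precedes it below -/
import Mathlib

section
/- Let γ, φ, σ² be real numbers with σ² > 0 and φ² ≤ 1. Then the asymptotic expected MSE of the residualization approach is at least that of the causality-aware approach in the single-feature case: 1 − γ²(1 − φ²)²/(σ² + γ²(1 − φ²)) ≥ 1 − γ²/(σ² + γ²). -/
/-- Single-feature case: for `σ² > 0` and `φ² ≤ 1`, the asymptotic expected MSE of the
residualization approach is at least that of the causality-aware approach:
`1 - γ²(1-φ²)²/(σ² + γ²(1-φ²)) ≥ 1 - γ²/(σ² + γ²)`. -/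
theorem mse_residualization_ge_causality_aware_single_feature
    (γ φ σ2 : ℝ) (hσ : 0 < σ2) (hφ : φ ^ 2 ≤ 1) :
    1 - γ ^ 2 * (1 - φ ^ 2) ^ 2 / (σ2 + γ ^ 2 * (1 - φ ^ 2))
      ≥ 1 - γ ^ 2 / (σ2 + γ ^ 2) := by
  have ht : 0 ≤ 1 - φ ^ 2 := sub_nonneg.2 hφ
  have hg : 0 ≤ γ ^ 2 := sq_nonneg γ
  have hp : 0 ≤ φ ^ 2 := sq_nonneg φ
  generalize γ ^ 2 = g at *
  generalize φ ^ 2 = p at *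
  refine sub_le_sub_left ?_ 1
  rw [div_le_div_iff₀ (by positivity) (by positivity), ← sub_nonneg]
  have key : g * (σ2 + g * (1 - p)) - g * (1 - p) ^ 2 * (σ2 + g)
      = g * (σ2 * (p * (1 + (1 - p))) + g * ((1 - p) * p)) := by ring
  rw [key]
  positivity
end

section
/- Let σ₁₁, σ₂₂, σ₁₂, γ₁, γ₂, φ be real numbers with D := σ₁₁σ₂₂ − σ₁₂² > 0, V := σ₁₁γ₂² + σ₂₂γ₁² − 2γ₁γ₂σ₁₂ ≥ 0, and φ² ≤ 1. Then the asymptotic expected MSE of residualization is at least that of the causality-aware approach in the two-feature case: 1 − V(1 − φ²)²/(D + V(1 − φ²)) ≥ 1 − V/(D + V). -/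
/-- Shrinking by a factor `t ∈ [0, 1]` decreases the ratio `v / (d + v)`, even after an extra
factor `t` in the numerator. -/
lemma mul_sq_div_add_mul_le_div_add {d v t : ℝ} (hd : 0 < d) (hv : 0 ≤ v) (ht₀ : 0 ≤ t)
    (ht₁ : t ≤ 1) : v * t ^ 2 / (d + v * t) ≤ v / (d + v) := by
  have h_sq : t ^ 2 ≤ t := by nlinarith
  have h_sq_one : t ^ 2 ≤ 1 := h_sq.trans ht₁
  rw [div_le_div_iff₀ (by positivity) (by positivity), mul_assoc]
  refine mul_le_mul_of_nonneg_left ?_ hv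
  nlinarith [mul_le_mul_of_nonneg_left h_sq hv, mul_le_mul_of_nonneg_left h_sq_one hd.le]

/-- Two-feature case: for `D = σ₁₁σ₂₂ - σ₁₂² > 0`,
`V = σ₁₁γ₂² + σ₂₂γ₁² - 2γ₁γ₂σ₁₂ ≥ 0`, and `φ² ≤ 1`, the asymptotic expected MSE of
residualization is at least that of the causality-aware approach:
`1 - V(1-φ²)²/(D + V(1-φ²)) ≥ 1 - V/(D + V)`. -/
theorem mse_residualization_ge_causality_aware_two_features
    (σ₁₁ σ₂₂ σ₁₂ γ₁ γ₂ φ : ℝ)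
    (hD : 0 < σ₁₁ * σ₂₂ - σ₁₂ ^ 2)
    (hV : 0 ≤ σ₁₁ * γ₂ ^ 2 + σ₂₂ * γ₁ ^ 2 - 2 * γ₁ * γ₂ * σ₁₂)
    (hφ : φ ^ 2 ≤ 1) :
    1 - (σ₁₁ * γ₂ ^ 2 + σ₂₂ * γ₁ ^ 2 - 2 * γ₁ * γ₂ * σ₁₂) * (1 - φ ^ 2) ^ 2
        / ((σ₁₁ * σ₂₂ - σ₁₂ ^ 2)
          + (σ₁₁ * γ₂ ^ 2 + σ₂₂ * γ₁ ^ 2 - 2 * γ₁ * γ₂ * σ₁₂) * (1 - φ ^ 2))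
      ≥ 1 - (σ₁₁ * γ₂ ^ 2 + σ₂₂ * γ₁ ^ 2 - 2 * γ₁ * γ₂ * σ₁₂)
        / ((σ₁₁ * σ₂₂ - σ₁₂ ^ 2)
          + (σ₁₁ * γ₂ ^ 2 + σ₂₂ * γ₁ ^ 2 - 2 * γ₁ * γ₂ * σ₁₂)) := by
  exact sub_le_sub_left (mul_sq_div_add_mul_le_div_add hD hV (sub_nonneg.2 hφ)
    (sub_le_self 1 (sq_nonneg φ))) 1
end
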